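/- Let G be a finite group. There exists a class c ∈ Ĥ^1(G, I_G) (represented by the 1-cocycle g ↦ g−1) such that for every G-module X and every i ∈ ℤ, the cup-product maps (−∪c) : Ĥ^i(G, Hom_ℤ(X, A)) → Ĥ^{i+1}(G, Hom_ℤ(X, A ⊗_ℤ I_G)) assemble into a natural isomorphism of functors Ĥ^i(G, Hom_ℤ(X, −)) ⇒ Ĥ^{i+1}(G, Hom_ℤ(X, − ⊗_ℤ I_G)) on the category of G-modules. -/

import Mathlib

/-!
This file sets up Tate cohomology of a finite group `G` (with coefficients in objects of
`Rep ℤ G`), realized concretely in each degree `n ∈ ℤ` as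
`Ĥ^n(G, M) = Ĥ⁰(G, Hom_ℤ(J n, M))`, where `J n` is the standard `n`-th syzygy of the
trivial module `ℤ` (the `n`-th tensor power of the augmentation ideal `I_G` for `n ≥ 0`,
and of its `ℤ`-linear dual for `n < 0`), and `Ĥ⁰` denotes invariants modulo norms.
Cup products are induced by the canonical comparison maps `J (i+j) ⟶ J i ⊗ J j`.
-/

open CategoryTheory MonoidalCategory TensorProduct

set_option linter.unusedSectionVars false
set_option maxHeartbeats 1000000

attribute [instance 0] AddCommGroup.toIntModule

namespace Enc

variable {k : Type} [CommRing k] {G : Type} [Group G] [Fintype G]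

/-! ### Degree-zero Tate cohomology: invariants modulo norms -/

section Aux
variable {V V₂ : Type} [AddCommGroup V] [Module k V] [AddCommGroup V₂] [Module k V₂]

/-- The norm map `v ↦ ∑_{g ∈ G} g • v` of a representation. -/
noncomputable def rnorm (ρ : Representation k G V) : V →ₗ[k] V := ∑ g : G, ρ g

lemma rnorm_mem_invariants (ρ : Representation k G V) (v : V) :
    rnorm ρ v ∈ ρ.invariants := by
  intro g
  show (ρ g) ((∑ h : G, ρ h) v) = _
  simp only [LinearMap.sum_apply, map_sum]
  rw [Fintype.sum_equiv (Equiv.mulLeft g) _ (fun h => ρ h v) (fun h => by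
    rw [← Module.End.mul_apply, ← map_mul]; rfl)]
  simp [rnorm]

/-- The norm map, viewed as landing in the invariants. -/
noncomputable def rnormRes (ρ : Representation k G V) : V →ₗ[k] ρ.invariants :=
  (rnorm ρ).codRestrict ρ.invariants (rnorm_mem_invariants ρ)

/-- The image of the norm map, inside the invariants. -/
noncomputable def rnormIm (ρ : Representation k G V) : Submodule k ρ.invariants :=
  LinearMap.range (rnormRes ρ)

/-- Degree-zero Tate cohomology of a representation: invariants modulo norms. -/
noncomputable def tate0 (ρ : Representation k G V) : Type :=
  ρ.invariants ⧸ rnormIm ρ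

noncomputable instance (ρ : Representation k G V) : AddCommGroup (tate0 ρ) :=
  inferInstanceAs (AddCommGroup (ρ.invariants ⧸ rnormIm ρ))

noncomputable instance (ρ : Representation k G V) : Module k (tate0 ρ) :=
  inferInstanceAs (Module k (ρ.invariants ⧸ rnormIm ρ))

/-- The Tate class of an invariant vector. -/
noncomputable def tate0mk {ρ : Representation k G V} (v : V) (hv : v ∈ ρ.invariants) :
    tate0 ρ := Submodule.Quotient.mk (⟨v, hv⟩ : ρ.invariants)

lemma invariants_comp {ρ : Representation k G V} {σ : Representation k G V₂}
    (f : V →ₗ[k] V₂) (hf : ∀ (g : G) (v : V), f (ρ g v) = σ g (f v)) :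
    ∀ x ∈ ρ.invariants, f x ∈ σ.invariants := by
  intro x hx g
  rw [← hf g x, hx g]

/-- Functoriality of degree-zero Tate cohomology along equivariant maps. -/
noncomputable def tate0map {ρ : Representation k G V} {σ : Representation k G V₂}
    (f : V →ₗ[k] V₂) (hf : ∀ (g : G) (v : V), f (ρ g v) = σ g (f v)) :
    tate0 ρ →ₗ[k] tate0 σ :=
  Submodule.mapQ (rnormIm ρ) (rnormIm σ) (f.restrict (invariants_comp f hf))
    (by
      rintro ⟨x, hx⟩ ⟨y, hy⟩
      refine ⟨f y, ?_⟩
      apply Subtype.ext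
      have hy' := congrArg Subtype.val hy
      show rnorm σ (f y) = _
      simp only [LinearMap.restrict_apply]
      have : rnorm σ (f y) = f (rnorm ρ y) := by
        simp only [rnorm, LinearMap.sum_apply, map_sum]
        exact Finset.sum_congr rfl fun g _ => (hf g y).symm
      rw [this]
      exact congrArg f hy')

end Aux

/-- Degree-zero Tate cohomology `Ĥ⁰(G, W) = W^G / N_G W` of an object of `Rep k G`. -/
noncomputable def H0T (W : Rep k G) : Type := tate0 W.ρ

noncomputable instance (W : Rep k G) : AddCommGroup (H0T W) :=
  inferInstanceAs (AddCommGroup (tate0 W.ρ))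

noncomputable instance (W : Rep k G) : Module k (H0T W) :=
  inferInstanceAs (Module k (tate0 W.ρ))

/-- Functoriality of `Ĥ⁰` along morphisms of representations. -/
noncomputable def H0Tmap {W W' : Rep k G} (ψ : W ⟶ W') : H0T W →ₗ[k] H0T W' :=
  tate0map ψ.hom (fun g v => Rep.hom_comm_apply ψ g v)

/-! ### The augmentation ideal and the syzygy modules `J n` -/

variable (G)

/-- The representation of `G` on `H →₀ k` induced by an action of `G` on `H` (the former meaning
of `Representation.ofMulAction`, which now lives on `MonoidAlgebra k H`). -/
noncomputable def ofMulActionFinsupp (k : Type*) [CommSemiring k] (G : Type*) [Monoid G]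
    (H : Type*) [MulAction G H] : Representation k G (H →₀ k) where
  toFun g := Finsupp.lmapDomain k k (g • ·)
  map_one' := by
    ext x y
    simp
  map_mul' x y := by
    ext z w
    simp [mul_smul]

/-- The augmentation map `ℤ[G] → ℤ`. -/
noncomputable def aug : (G →₀ ℤ) →ₗ[ℤ] ℤ :=
  Finsupp.linearCombination ℤ (fun _ : G => (1 : ℤ))

lemma aug_comm (g : G) (x : G →₀ ℤ) :
    aug G (ofMulActionFinsupp ℤ G G g x) = aug G x := by
  unfold aug
  simp [ofMulActionFinsupp, Finsupp.linearCombination_apply]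
  rw [Finsupp.sum_mapDomain_index] <;> simp

/-- The underlying `ℤ`-module of the augmentation ideal. -/
noncomputable abbrev IGcar : Type := LinearMap.ker (aug G)

/-- The representation of `G` on the augmentation ideal. -/
noncomputable def IGρ : Representation ℤ G (IGcar G) where
  toFun g := (ofMulActionFinsupp ℤ G G g).restrict (p := LinearMap.ker (aug G))
    (q := LinearMap.ker (aug G)) (by
      intro x hx
      simp only [LinearMap.mem_ker] at hx ⊢
      rw [aug_comm]; exact hx)
  map_one' := by ext x; simp [LinearMap.restrict_apply]
  map_mul' g h := by ext x; simp [LinearMap.restrict_apply, Module.End.mul_apply]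

/-- The augmentation ideal `I_G` of `ℤ[G]`, as an object of `Rep ℤ G`. -/
noncomputable def IGrep : Rep ℤ G := Rep.of (IGρ G)

/-- `Hom_ℤ(X, A)` with the conjugation `G`-action, i.e. the internal hom in `Rep ℤ G`. -/
noncomputable abbrev hRep {G : Type} [Group G] (X A : Rep.{0} ℤ G) : Rep.{0} ℤ G :=
  (Rep.ihom X).obj A

/-- The `ℤ`-linear dual of the augmentation ideal, as an object of `Rep ℤ G`. -/
noncomputable def DIG : Rep ℤ G := hRep (IGrep G) (𝟙_ (Rep ℤ G))

instance : Module.Finite ℤ (IGcar G) := by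
  have : Module.Finite ℤ (G →₀ ℤ) :=
    Module.Finite.equiv (Finsupp.linearEquivFunOnFinite ℤ ℤ G).symm
  exact Module.Finite.of_injective (LinearMap.ker (aug G)).subtype Subtype.val_injective

instance : Module.Free ℤ (IGcar G) := by infer_instance

/-- Nonnegative tensor powers `I_G^{⊗ n}` (with `I_G^{⊗ 0} = ℤ`). -/
noncomputable def Jp : ℕ → Rep ℤ G
  | 0 => 𝟙_ (Rep ℤ G)
  | n + 1 => Jp n ⊗ IGrep G

/-- Tensor powers of the dual of the augmentation ideal. -/
noncomputable def Jn : ℕ → Rep ℤ G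
  | 0 => 𝟙_ (Rep ℤ G)
  | n + 1 => Jn n ⊗ DIG G

/-- The standard syzygy modules of the trivial representation `ℤ`, indexed by `ℤ`:
`J n = I_G^{⊗ n}` for `n ≥ 0`, and `J n = (I_G^∨)^{⊗ (-n)}` for `n < 0`. -/
noncomputable def J : ℤ → Rep ℤ G
  | .ofNat n => Jp G n
  | .negSucc n => Jn G (n + 1)

lemma J_ofNat (m : ℕ) : J G (m : ℤ) = Jp G m := rfl

lemma J_neg (m : ℕ) : J G (-(m : ℤ)) = Jn G m := by cases m <;> rfl

/-- The element of `(I_G)^∨ ⊗ I_G` corresponding to the identity map. -/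
noncomputable def preElt : Module.Dual ℤ (IGcar G) ⊗[ℤ] IGcar G :=
  (dualTensorHomEquiv ℤ (IGcar G) (IGcar G)).symm LinearMap.id

/-- The canonical element of `I_G ⊗ (I_G)^∨` corresponding to the identity map. -/
noncomputable def coevElt : (IGrep G ⊗ DIG G).V :=
  (TensorProduct.comm ℤ _ _) (preElt G)

lemma conj_dualTensor (g : G) (t : Module.Dual ℤ (IGcar G) ⊗[ℤ] IGcar G) :
    dualTensorHom ℤ _ _ (TensorProduct.map ((DIG G).ρ g) ((IGrep G).ρ g) t)
      = (IGrep G).ρ g ∘ₗ (dualTensorHom ℤ _ _ t) ∘ₗ (IGrep G).ρ g⁻¹ := by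
  have key : ∀ (a : Module.Dual ℤ (IGcar G) →ₗ[ℤ] Module.Dual ℤ (IGcar G))
      (b c : IGcar G →ₗ[ℤ] IGcar G) (_ : ∀ f : Module.Dual ℤ (IGcar G), a f = f ∘ₗ c)
      (t : Module.Dual ℤ (IGcar G) ⊗[ℤ] IGcar G),
      dualTensorHom ℤ (IGcar G) (IGcar G) (TensorProduct.map a b t)
        = b ∘ₗ (dualTensorHom ℤ (IGcar G) (IGcar G) t) ∘ₗ c := by
    intro a b c h t
    induction t with
    | zero => simp
    | tmul f v =>
        apply LinearMap.ext
        intro w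
        simp only [TensorProduct.map_tmul, dualTensorHom_apply,
          LinearMap.comp_apply, map_smul, h]
    | add x y hx hy =>
        simp only [map_add, hx, hy, LinearMap.add_comp, LinearMap.comp_add]
  exact key _ _ _ (fun f => rfl) t

lemma coevElt_invariant (g : G) :
    ((IGrep G ⊗ DIG G).ρ g) (coevElt G) = coevElt G := by
  show TensorProduct.map ((IGrep G).ρ g) ((DIG G).ρ g)
      ((TensorProduct.comm ℤ _ _) (preElt G)) = _
  refine (TensorProduct.map_comm ((IGrep G).ρ g) ((DIG G).ρ g) (preElt G)).trans ?_
  show (TensorProduct.comm ℤ _ _) (TensorProduct.map ((DIG G).ρ g) ((IGrep G).ρ g) (preElt G))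
      = (TensorProduct.comm ℤ _ _) (preElt G)
  congr 1
  apply (dualTensorHomEquiv ℤ (IGcar G) (IGcar G)).injective
  have h2 : dualTensorHom ℤ (IGcar G) (IGcar G) (preElt G) = LinearMap.id :=
    (dualTensorHomEquiv ℤ (IGcar G) (IGcar G)).apply_symm_apply LinearMap.id
  show dualTensorHom ℤ (IGcar G) (IGcar G)
      (TensorProduct.map ((DIG G).ρ g) ((IGrep G).ρ g) (preElt G))
    = dualTensorHom ℤ (IGcar G) (IGcar G) (preElt G)
  refine (conj_dualTensor G g (preElt G)).trans ?_
  show (IGrep G).ρ g ∘ₗ dualTensorHom ℤ (IGcar G) (IGcar G) (preElt G) ∘ₗ (IGrep G).ρ g⁻¹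
      = dualTensorHom ℤ (IGcar G) (IGcar G) (preElt G)
  rw [h2]
  apply LinearMap.ext
  intro v
  exact Representation.self_inv_apply (IGrep G).ρ g v

/-- The coevaluation `ℤ ⟶ I_G ⊗ I_G^∨`. -/
noncomputable def coev : 𝟙_ (Rep ℤ G) ⟶ IGrep G ⊗ DIG G :=
  Rep.ofHom (ρ := (𝟙_ (Rep ℤ G)).ρ) (σ := (IGrep G ⊗ DIG G).ρ)
  { toLinearMap := LinearMap.toSpanSingleton ℤ _ (coevElt G)
    isIntertwining' := by
      intro g
      apply LinearMap.ext
      intro z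
      show LinearMap.toSpanSingleton ℤ _ (coevElt G) ((𝟙_ (Rep ℤ G)).ρ g z)
          = ((IGrep G ⊗ DIG G).ρ g) (LinearMap.toSpanSingleton ℤ _ (coevElt G) z)
      have hz : ((𝟙_ (Rep ℤ G)).ρ g z) = z := rfl
      rw [hz]
      show z • coevElt G = ((IGrep G ⊗ DIG G).ρ g) (z • coevElt G)
      rw [map_smul, coevElt_invariant] }


variable {G}

/-- One-step comparison `J (n+1) ⟶ J n ⊗ I_G`. -/
noncomputable def sMap : ∀ n : ℤ, J G (n + 1) ⟶ J G n ⊗ IGrep G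
  | .ofNat m => 𝟙 (Jp G m ⊗ IGrep G)
  | .negSucc 0 =>
      coev G ≫ (β_ (IGrep G) (DIG G)).hom ≫ ((λ_ (DIG G)).inv ▷ IGrep G)
  | .negSucc (m+1) =>
      (ρ_ (Jn G (m+1))).inv ≫ (Jn G (m+1) ◁ (coev G ≫ (β_ (IGrep G) (DIG G)).hom))
        ≫ (α_ (Jn G (m+1)) (DIG G) (IGrep G)).inv

/-- One-step comparison `J (n-1) ⟶ J n ⊗ I_G^∨`. -/
noncomputable def tMap : ∀ n : ℤ, J G (n - 1) ⟶ J G n ⊗ DIG G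
  | .ofNat 0 => 𝟙 (𝟙_ (Rep ℤ G) ⊗ DIG G)
  | .ofNat (m+1) =>
      eqToHom (congrArg (J G) (show (Int.ofNat (m+1)) - 1 = ((m:ℕ) : ℤ) by
        rw [Int.ofNat_eq_coe]; push_cast; ring)) ≫
      (ρ_ (Jp G m)).inv ≫ (Jp G m ◁ coev G) ≫ (α_ (Jp G m) (IGrep G) (DIG G)).inv
  | .negSucc m => eqToHom (show J G (Int.negSucc m - 1) = J G (Int.negSucc m) ⊗ DIG G from rfl)

/-- Comparison maps `J (i + m) ⟶ J i ⊗ J m` for `m ≥ 0`. -/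
noncomputable def μpos (i : ℤ) : ∀ m : ℕ, J G (i + m) ⟶ J G i ⊗ J G (m : ℤ)
  | 0 => eqToHom (congrArg (J G) (by omega)) ≫ (ρ_ (J G i)).inv
  | m + 1 =>
      eqToHom (congrArg (J G) (show i + ((m:ℕ)+1:ℕ) = (i + m) + 1 by omega))
        ≫ sMap (i + m) ≫ (μpos i m ▷ IGrep G) ≫ (α_ (J G i) (J G (m:ℤ)) (IGrep G)).hom

/-- Comparison maps `J (i - m) ⟶ J i ⊗ J (-m)` for `m ≥ 0`. -/
noncomputable def μneg (i : ℤ) : ∀ m : ℕ, J G (i - m) ⟶ J G i ⊗ J G (-(m : ℤ))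
  | 0 => eqToHom (congrArg (J G) (by omega)) ≫ (ρ_ (J G i)).inv
  | m + 1 =>
      eqToHom (congrArg (J G) (show i - ((m:ℕ)+1:ℕ) = (i - m) - 1 by omega))
        ≫ tMap (i - m) ≫ (μneg i m ▷ DIG G) ≫ (α_ (J G i) (J G (-(m:ℤ))) (DIG G)).hom
        ≫ (J G i ◁ (eqToHom (show J G (-(m:ℤ)) ⊗ DIG G = J G (-((m:ℕ)+1:ℕ)) by
            rw [J_neg, J_neg]; rfl)))

variable (G)

/-- The canonical comparison map `J (i+j) ⟶ J i ⊗ J j`, implementing the standard stable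
equivalences between the syzygies `J`; it induces the cup product on Tate cohomology. -/
noncomputable def μ (i : ℤ) : ∀ j : ℤ, J G (i + j) ⟶ J G i ⊗ J G j
  | .ofNat m => μpos i m
  | .negSucc m =>
      eqToHom (congrArg (J G) (show i + Int.negSucc m = i - ((m+1 : ℕ) : ℤ) by
        rw [Int.negSucc_eq]; push_cast; ring))
        ≫ μneg i (m+1)

variable {G}

/-! ### Tate cohomology in all degrees, functoriality, cup products -/

/-- Tate cohomology `Ĥ^n(G, M)` of the finite group `G` with coefficients in `M : Rep ℤ G`,
realized as `Ĥ⁰(G, Hom_ℤ(J n, M))` for the standard `n`-th syzygy `J n` of `ℤ`. -/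
noncomputable def tate (n : ℤ) (M : Rep ℤ G) : Type := H0T (hRep (J G n) M)

noncomputable instance (n : ℤ) (M : Rep ℤ G) : AddCommGroup (tate n M) :=
  inferInstanceAs (AddCommGroup (H0T (hRep (J G n) M)))

/-- The map on Tate cohomology induced by a morphism of representations. -/
noncomputable def tmap (n : ℤ) {M N : Rep ℤ G} (φ : M ⟶ N) : tate n M → tate n N :=
  H0Tmap ((Rep.ihom (J G n)).map φ)

/-- Transport of Tate cohomology along an equality of degrees. -/
noncomputable def tcast {i j : ℤ} {M : Rep ℤ G} (h : i = j) (z : tate i M) : tate j M :=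
  h ▸ z

lemma hom_invariant {X W : Rep.{0} ℤ G} (m : X ⟶ W) :
    m.hom.toLinearMap ∈ (hRep X W).ρ.invariants := by
  intro g
  show W.ρ g ∘ₗ m.hom.toLinearMap ∘ₗ X.ρ g⁻¹ = m.hom.toLinearMap
  ext v
  simp only [LinearMap.comp_apply]
  erw [Rep.hom_comm_apply m g⁻¹ v, Representation.self_inv_apply]; rfl

/-- The Tate cohomology class of a `G`-equivariant map `J n ⟶ W`. -/
noncomputable def mkCls {n : ℤ} {W : Rep ℤ G} (m : J G n ⟶ W) : tate n W :=
  tate0mk m.hom.toLinearMap (hom_invariant m)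


lemma tensor_rho_eq (M N : Rep ℤ G) (g : G) :
    (M ⊗ N).ρ g = TensorProduct.map (M.ρ g) (N.ρ g) := rfl

lemma cup_invariance {i j : ℤ} {M N : Rep ℤ G}
    (f : ((hRep (J G i) M).ρ.invariants))
    (g : ((hRep (J G j) N).ρ.invariants)) :
    (TensorProduct.map f.1 g.1).comp ((μ G i j).hom.toLinearMap)
      ∈ (hRep (J G (i + j)) (M ⊗ N)).ρ.invariants := by
  intro gg
  have hf : M.ρ gg ∘ₗ f.1 ∘ₗ (J G i).ρ gg⁻¹ = f.1 := f.2 gg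
  have hg : N.ρ gg ∘ₗ g.1 ∘ₗ (J G j).ρ gg⁻¹ = g.1 := g.2 gg
  have hμ : (μ G i j).hom.toLinearMap.comp ((J G (i + j)).ρ gg⁻¹)
      = (TensorProduct.map ((J G i).ρ gg⁻¹) ((J G j).ρ gg⁻¹)).comp (μ G i j).hom.toLinearMap := by
    have h := (μ G i j).hom.isIntertwining' gg⁻¹
    exact h
  show (M ⊗ N).ρ gg ∘ₗ ((TensorProduct.map f.1 g.1).comp (μ G i j).hom.toLinearMap)
        ∘ₗ (J G (i + j)).ρ gg⁻¹
      = (TensorProduct.map f.1 g.1).comp (μ G i j).hom.toLinearMap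
  have key : ∀ (f : (J G i).V →ₗ[ℤ] M.V) (g : (J G j).V →ₗ[ℤ] N.V)
      (_ : M.ρ gg ∘ₗ f ∘ₗ (J G i).ρ gg⁻¹ = f) (_ : N.ρ gg ∘ₗ g ∘ₗ (J G j).ρ gg⁻¹ = g),
      TensorProduct.map (M.ρ gg) (N.ρ gg) ∘ₗ
          ((TensorProduct.map f g).comp (μ G i j).hom.toLinearMap) ∘ₗ (J G (i + j)).ρ gg⁻¹
        = (TensorProduct.map f g).comp (μ G i j).hom.toLinearMap := by
    intro f g hf hg
    refine (congrArg (fun t => TensorProduct.map (M.ρ gg) (N.ρ gg) ∘ₗ TensorProduct.map f g ∘ₗ t)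
      hμ).trans ?_
    conv_rhs => rw [← hf, ← hg]
    rw [TensorProduct.map_comp, TensorProduct.map_comp]
    rfl
  exact key f.1 g.1 hf hg

lemma conj_term {i j : ℤ} {M N : Rep ℤ G} (u : (J G i).V →ₗ[ℤ] M.V)
    (w : (J G j).V →ₗ[ℤ] N.V) (h : G) :
    (TensorProduct.map (M.ρ h ∘ₗ u ∘ₗ (J G i).ρ h⁻¹) (N.ρ h ∘ₗ w ∘ₗ (J G j).ρ h⁻¹)).comp
        (μ G i j).hom.toLinearMap
      = ((hRep (J G (i + j)) (M ⊗ N)).ρ h) ((TensorProduct.map u w).comp (μ G i j).hom.toLinearMap) := by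
  have hμ : (μ G i j).hom.toLinearMap ∘ₗ (J G (i + j)).ρ h⁻¹
      = TensorProduct.map ((J G i).ρ h⁻¹) ((J G j).ρ h⁻¹) ∘ₗ (μ G i j).hom.toLinearMap := by
    have hc := (μ G i j).hom.isIntertwining' h⁻¹
    exact hc
  show _ = (M ⊗ N).ρ h ∘ₗ ((TensorProduct.map u w).comp (μ G i j).hom.toLinearMap) ∘ₗ (J G (i + j)).ρ h⁻¹
  rw [LinearMap.comp_assoc, hμ, ← LinearMap.comp_assoc, ← LinearMap.comp_assoc]
  rw [TensorProduct.map_comp, TensorProduct.map_comp]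
  rfl

lemma cup_norm_left {i j : ℤ} {M N : Rep ℤ G} (u : (J G i).V →ₗ[ℤ] M.V)
    (g : ((hRep (J G j) N).ρ.invariants)) :
    (TensorProduct.map (rnorm ((hRep (J G i) M).ρ) u) g.1).comp (μ G i j).hom.toLinearMap
      = rnorm ((hRep (J G (i + j)) (M ⊗ N)).ρ)
          ((TensorProduct.map u g.1).comp (μ G i j).hom.toLinearMap) := by
  have h1 : rnorm ((hRep (J G i) M).ρ) u = ∑ h : G, ((hRep (J G i) M).ρ h) u := by
    exact LinearMap.sum_apply _ _ _
  have h2 : rnorm ((hRep (J G (i + j)) (M ⊗ N)).ρ) ((TensorProduct.map u g.1).comp (μ G i j).hom.toLinearMap)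
      = ∑ h : G, ((hRep (J G (i + j)) (M ⊗ N)).ρ h)
          ((TensorProduct.map u g.1).comp (μ G i j).hom.toLinearMap) := by
    exact LinearMap.sum_apply _ _ _
  rw [h1, h2]
  have h3 : ∀ (F : G → ((J G i).V →ₗ[ℤ] M.V)) (g : (J G j).V →ₗ[ℤ] N.V) (s : Finset G),
      (TensorProduct.map (∑ h ∈ s, F h) g).comp (μ G i j).hom.toLinearMap
        = ∑ h ∈ s, (TensorProduct.map (F h) g).comp (μ G i j).hom.toLinearMap := by
    classical
    intro F g s
    induction s using Finset.induction_on with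
    | empty =>
        rw [Finset.sum_empty, Finset.sum_empty, TensorProduct.map_zero_left]
        exact LinearMap.zero_comp _
    | insert a s ha ih =>
        rw [Finset.sum_insert ha, Finset.sum_insert ha, TensorProduct.map_add_left, ← ih]
        exact LinearMap.add_comp _ _ _
  refine (h3 (fun h => ((hRep (J G i) M).ρ h) u) g.1 Finset.univ).trans ?_
  refine Finset.sum_congr rfl fun h _ => ?_
  have hginv : N.ρ h ∘ₗ g.1 ∘ₗ (J G j).ρ h⁻¹ = g.1 := g.2 h
  refine Eq.trans ?_ (conj_term u g.1 h)
  exact congrArg (fun w : (J G j).V →ₗ[ℤ] N.V => (TensorProduct.map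
    (M.ρ h ∘ₗ u ∘ₗ (J G i).ρ h⁻¹) w).comp (μ G i j).hom.toLinearMap) hginv.symm

lemma cup_norm_right {i j : ℤ} {M N : Rep ℤ G}
    (f : ((hRep (J G i) M).ρ.invariants)) (w : (J G j).V →ₗ[ℤ] N.V) :
    (TensorProduct.map f.1 (rnorm ((hRep (J G j) N).ρ) w)).comp (μ G i j).hom.toLinearMap
      = rnorm ((hRep (J G (i + j)) (M ⊗ N)).ρ)
          ((TensorProduct.map f.1 w).comp (μ G i j).hom.toLinearMap) := by
  have h1 : rnorm ((hRep (J G j) N).ρ) w = ∑ h : G, ((hRep (J G j) N).ρ h) w := by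
    exact LinearMap.sum_apply _ _ _
  have h2 : rnorm ((hRep (J G (i + j)) (M ⊗ N)).ρ) ((TensorProduct.map f.1 w).comp (μ G i j).hom.toLinearMap)
      = ∑ h : G, ((hRep (J G (i + j)) (M ⊗ N)).ρ h)
          ((TensorProduct.map f.1 w).comp (μ G i j).hom.toLinearMap) := by
    exact LinearMap.sum_apply _ _ _
  rw [h1, h2]
  have h3 : ∀ (f : (J G i).V →ₗ[ℤ] M.V) (F : G → ((J G j).V →ₗ[ℤ] N.V)) (s : Finset G),
      (TensorProduct.map f (∑ h ∈ s, F h)).comp (μ G i j).hom.toLinearMap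
        = ∑ h ∈ s, (TensorProduct.map f (F h)).comp (μ G i j).hom.toLinearMap := by
    classical
    intro f F s
    induction s using Finset.induction_on with
    | empty =>
        rw [Finset.sum_empty, Finset.sum_empty, TensorProduct.map_zero_right]
        exact LinearMap.zero_comp _
    | insert a s ha ih =>
        rw [Finset.sum_insert ha, Finset.sum_insert ha, TensorProduct.map_add_right, ← ih]
        exact LinearMap.add_comp _ _ _
  refine (h3 f.1 (fun h => ((hRep (J G j) N).ρ h) w) Finset.univ).trans ?_
  refine Finset.sum_congr rfl fun h _ => ?_
  have hfinv : M.ρ h ∘ₗ f.1 ∘ₗ (J G i).ρ h⁻¹ = f.1 := f.2 h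
  refine Eq.trans ?_ (conj_term f.1 w h)
  exact congrArg (fun u : (J G i).V →ₗ[ℤ] M.V => (TensorProduct.map
    u (N.ρ h ∘ₗ w ∘ₗ (J G j).ρ h⁻¹)).comp (μ G i j).hom.toLinearMap) hfinv.symm

lemma cup_welldef {i j : ℤ} {M N : Rep ℤ G}
    (a₁ : ((hRep (J G i) M).ρ.invariants)) (b₁ : ((hRep (J G j) N).ρ.invariants))
    (a₂ : ((hRep (J G i) M).ρ.invariants)) (b₂ : ((hRep (J G j) N).ρ.invariants))
    (ha : a₁ - a₂ ∈ rnormIm ((hRep (J G i) M).ρ))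
    (hb : b₁ - b₂ ∈ rnormIm ((hRep (J G j) N).ρ)) :
    tate0mk (ρ := (hRep (J G (i + j)) (M ⊗ N)).ρ) ((TensorProduct.map a₁.1 b₁.1).comp ((μ G i j).hom.toLinearMap)) (cup_invariance a₁ b₁)
      = tate0mk (ρ := (hRep (J G (i + j)) (M ⊗ N)).ρ) ((TensorProduct.map a₂.1 b₂.1).comp ((μ G i j).hom.toLinearMap)) (cup_invariance a₂ b₂) := by
  obtain ⟨u, hu⟩ := ha
  obtain ⟨w, hw⟩ := hb
  have hu' : rnorm ((hRep (J G i) M).ρ) u = a₁.1 - a₂.1 := congrArg Subtype.val hu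
  have hw' : rnorm ((hRep (J G j) N).ρ) w = b₁.1 - b₂.1 := congrArg Subtype.val hw
  have step1 : tate0mk (ρ := (hRep (J G (i + j)) (M ⊗ N)).ρ) ((TensorProduct.map a₁.1 b₁.1).comp ((μ G i j).hom.toLinearMap))
        (cup_invariance a₁ b₁)
      = tate0mk (ρ := (hRep (J G (i + j)) (M ⊗ N)).ρ) ((TensorProduct.map a₂.1 b₁.1).comp ((μ G i j).hom.toLinearMap)) (cup_invariance a₂ b₁) := by
    refine (Submodule.Quotient.eq _).mpr ?_
    refine ⟨(TensorProduct.map u b₁.1).comp ((μ G i j).hom.toLinearMap), ?_⟩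
    apply Subtype.ext
    have key := cup_norm_left u b₁
    rw [hu'] at key
    refine key.symm.trans ?_
    show _ = (TensorProduct.map a₁.1 b₁.1).comp ((μ G i j).hom.toLinearMap)
        - (TensorProduct.map a₂.1 b₁.1).comp ((μ G i j).hom.toLinearMap)
    have h4 : ∀ (p q : (J G i).V →ₗ[ℤ] M.V) (r : (J G j).V →ₗ[ℤ] N.V),
        (TensorProduct.map (p - q) r).comp (μ G i j).hom.toLinearMap
          = (TensorProduct.map p r).comp (μ G i j).hom.toLinearMap
            - (TensorProduct.map q r).comp (μ G i j).hom.toLinearMap := by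
      intro p q r
      rw [← LinearMap.sub_comp]
      congr 1
      exact eq_sub_of_add_eq (by rw [← TensorProduct.map_add_left, sub_add_cancel])
    exact h4 a₁.1 a₂.1 b₁.1
  have step2 : tate0mk (ρ := (hRep (J G (i + j)) (M ⊗ N)).ρ) ((TensorProduct.map a₂.1 b₁.1).comp ((μ G i j).hom.toLinearMap))
        (cup_invariance a₂ b₁)
      = tate0mk (ρ := (hRep (J G (i + j)) (M ⊗ N)).ρ) ((TensorProduct.map a₂.1 b₂.1).comp ((μ G i j).hom.toLinearMap)) (cup_invariance a₂ b₂) := by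
    refine (Submodule.Quotient.eq _).mpr ?_
    refine ⟨(TensorProduct.map a₂.1 w).comp ((μ G i j).hom.toLinearMap), ?_⟩
    apply Subtype.ext
    have key := cup_norm_right a₂ w
    rw [hw'] at key
    refine key.symm.trans ?_
    show _ = (TensorProduct.map a₂.1 b₁.1).comp ((μ G i j).hom.toLinearMap)
        - (TensorProduct.map a₂.1 b₂.1).comp ((μ G i j).hom.toLinearMap)
    have h4 : ∀ (p q : (J G j).V →ₗ[ℤ] N.V) (r : (J G i).V →ₗ[ℤ] M.V),
        (TensorProduct.map r (p - q)).comp (μ G i j).hom.toLinearMap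
          = (TensorProduct.map r p).comp (μ G i j).hom.toLinearMap
            - (TensorProduct.map r q).comp (μ G i j).hom.toLinearMap := by
      intro p q r
      rw [← LinearMap.sub_comp]
      congr 1
      exact eq_sub_of_add_eq (by rw [← TensorProduct.map_add_right, sub_add_cancel])
    exact h4 b₁.1 b₂.1 a₂.1
  exact step1.trans step2

/-- The cup product `Ĥ^i(G, M) × Ĥ^j(G, N) → Ĥ^{i+j}(G, M ⊗ N)` on Tate cohomology,
induced by the comparison maps `μ`. -/
noncomputable def cup {i j : ℤ} {M N : Rep ℤ G} (z₁ : tate i M) (z₂ : tate j N) :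
    tate (i + j) (M ⊗ N) :=
  Quotient.liftOn₂ z₁ z₂
    (fun f g => tate0mk ((TensorProduct.map f.1 g.1).comp ((μ G i j).hom.toLinearMap)) (cup_invariance f g))
    (fun a₁ b₁ a₂ b₂ ha hb => cup_welldef a₁ b₁ a₂ b₂
      ((Submodule.quotientRel_def _).mp ha) ((Submodule.quotientRel_def _).mp hb))

/-! ### Pairings -/

/-- The composition pairing `Hom_ℤ(B, C) ⊗ Hom_ℤ(A, B) ⟶ Hom_ℤ(A, C)`, `f ⊗ φ ↦ f ∘ φ`. -/
noncomputable def compPair (A B C : Rep ℤ G) : hRep B C ⊗ hRep A B ⟶ hRep A C :=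
  MonoidalClosed.curry <|
    (A ◁ (β_ (hRep B C) (hRep A B)).hom) ≫ (α_ A (hRep A B) (hRep B C)).inv
      ≫ (((ihom.ev A).app B) ▷ hRep B C) ≫ (ihom.ev B).app C

/-- The evaluation pairing `Hom_ℤ(X, B) ⊗ X ⟶ B`, `f ⊗ x ↦ f x`. -/
noncomputable def evPair (X B : Rep ℤ G) : hRep X B ⊗ X ⟶ B :=
  (β_ (hRep X B) X).hom ≫ (ihom.ev X).app B

/-- The cup product `Ĥ^i(G, Hom(X, A)) × Ĥ^j(G, Hom(X', X)) → Ĥ^{i+j}(G, Hom(X', A))`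
induced by the composition pairing. -/
noncomputable def ccup {i j : ℤ} {X X' A : Rep ℤ G}
    (z : tate i (hRep X A)) (x : tate j (hRep X' X)) : tate (i + j) (hRep X' A) :=
  tmap (i + j) (compPair X' X A) (cup z x)

/-- `ccup`, with the degree of the target adjusted along an equality of integers. -/
noncomputable def ccupTo {i j m : ℤ} {X X' A : Rep ℤ G}
    (z : tate i (hRep X A)) (x : tate j (hRep X' X)) (h : i + j = m) :
    tate m (hRep X' A) :=
  tcast h (ccup z x)

/-- The class of the identity in `Ĥ⁰(G, Hom_ℤ(X, X))`. -/
noncomputable def idCls (X : Rep ℤ G) : tate 0 (hRep X X) :=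
  mkCls (MonoidalClosed.curry (ρ_ X).hom)

/-! ### Encoding pairs and related notions -/

/-- `(X, X')` is an *`r`-encoding pair* if for some `i ∈ ℤ` there is a natural isomorphism
of functors `Ĥ^i(G, Hom_ℤ(X, -)) ≅ Ĥ^{i+r}(G, Hom_ℤ(X', -))` on `Rep ℤ G`. -/
def IsEncodingPair {G : Type} [Group G] [Fintype G] (r : ℤ) (X X' : Rep ℤ G) : Prop :=
  ∃ (i : ℤ) (e : ∀ A : Rep ℤ G, tate i (hRep X A) ≃+ tate (i + r) (hRep X' A)),
    ∀ {A B : Rep ℤ G} (φ : A ⟶ B) (z : tate i (hRep X A)),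
      e B (tmap i ((Rep.ihom X).map φ) z) = tmap (i + r) ((Rep.ihom X').map φ) (e A z)

/-- `x ∈ Ĥ^r(G, Hom_ℤ(X', X))` is an *encoding element* for the pair `(X, X')` if it has a
*decoding element* `x' ∈ Ĥ^{-r}(G, Hom_ℤ(X, X'))` with `x' ∪ x = [id_{X'}]` and
`x ∪ x' = [id_X]`. -/
def IsEncodingElement {G : Type} [Group G] [Fintype G] {r : ℤ} (X X' : Rep ℤ G)
    (x : tate r (hRep X' X)) : Prop :=
  ∃ x' : tate (-r) (hRep X X'),
    ccupTo x' x (by ring) = idCls X' ∧ ccupTo x x' (by ring) = idCls X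

/-- The induced `G`-module `ℤ[G] ⊗_ℤ A ≅ (G →₀ A)`, with `G` acting by left translation. -/
noncomputable def indRep (G : Type) [Group G] (A : Type) [AddCommGroup A] [Module ℤ A] :
    Rep ℤ G :=
  Rep.of (G := G) (X := G →₀ A)
    { toFun := fun g => Finsupp.lmapDomain A ℤ (fun h => g * h)
      map_one' := by
        ext x h
        simp [Finsupp.lmapDomain_apply, Finsupp.mapDomain_id, one_mul]
      map_mul' := fun g g' => by
        ext x h
        simp [Finsupp.lmapDomain_apply, Module.End.mul_apply, Finsupp.mapDomain_single,
          mul_assoc] }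

/-- A `G`-module is *induced* if it is isomorphic to `ℤ[G] ⊗_ℤ A` for some abelian group `A`. -/
def IsInduced {G : Type} [Group G] (M : Rep ℤ G) : Prop :=
  ∃ (A : Type) (_ : AddCommGroup A) (_ : Module ℤ A), Nonempty (M ≅ indRep G A)

/-- A class `φ ∈ Ĥ⁰(G, Hom_ℤ(X, X))` is a unit for the (composition) cup product. -/
def IsUnitCls {G : Type} [Group G] [Fintype G] {X : Rep ℤ G}
    (φ : tate 0 (hRep X X)) : Prop :=
  ∃ ψ : tate 0 (hRep X X),
    ccupTo φ ψ (by ring) = idCls X ∧ ccupTo ψ φ (by ring) = idCls X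


/-- The natural map `Hom_ℤ(X, A) ⊗ I_G ⟶ Hom_ℤ(X, A ⊗ I_G)`, `f ⊗ z ↦ (x ↦ f x ⊗ z)`. -/
noncomputable def pr0 (X A : Rep ℤ G) : hRep X A ⊗ IGrep G ⟶ hRep X (A ⊗ IGrep G) :=
  MonoidalClosed.curry ((α_ X (hRep X A) (IGrep G)).inv ≫ ((ihom.ev X).app A ▷ IGrep G))

/-- The natural evaluation map `Hom_ℤ(X, Hom_ℤ(I_G, A)) ⊗ I_G ⟶ Hom_ℤ(X, A)`,
`f ⊗ z ↦ (x ↦ f x z)`. -/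
noncomputable def pr1 (X A : Rep ℤ G) :
    hRep X (hRep (IGrep G) A) ⊗ IGrep G ⟶ hRep X A :=
  MonoidalClosed.curry ((α_ X (hRep X (hRep (IGrep G) A)) (IGrep G)).inv
    ≫ ((ihom.ev X).app (hRep (IGrep G) A) ▷ IGrep G) ≫ evPair (IGrep G) A)

/-- The natural evaluation map `Hom_ℤ(X', X) ⊗ (X' ⊗ A) ⟶ X ⊗ A`. -/
noncomputable def tPair (X' X A : Rep ℤ G) : hRep X' X ⊗ (X' ⊗ A) ⟶ X ⊗ A :=
  (α_ (hRep X' X) X' A).inv ≫ (evPair X' X ▷ A)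

/-- A functor `Rep ℤ G ⥤ Rep ℤ G` sends `ℤ`-split short exact sequences of `G`-modules to
short exact sequences of `G`-modules. -/
def PreservesZSplitSES {G : Type} [Group G] (F : Rep.{0} ℤ G ⥤ Rep.{0} ℤ G) : Prop :=
  ∀ (A B C : Rep.{0} ℤ G) (f : A ⟶ B) (g : B ⟶ C),
    Function.Injective f.hom → Function.Surjective g.hom → Function.Exact f.hom g.hom →
    (∃ s : C.V →+ B.V, ∀ x, g.hom (s x) = x) →
    Function.Injective (F.map f).hom ∧ Function.Surjective (F.map g).hom ∧
      Function.Exact (F.map f).hom (F.map g).hom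

/-- A *shiftable functor*: it sends `ℤ`-split short exact sequences of `G`-modules to short
exact sequences, and sends induced modules to induced modules. -/
def Shiftable {G : Type} [Group G] (F : Rep.{0} ℤ G ⥤ Rep.{0} ℤ G) : Prop :=
  PreservesZSplitSES F ∧ ∀ M : Rep ℤ G, IsInduced M → IsInduced (F.obj M)

end Enc

namespace EncPf

/-! ### Congruences on monoidal categories -/

/-- A congruence relation on the morphisms of a monoidal category, stable under whiskering. -/
structure MCong (C : Type*) [Category C] [MonoidalCategory C] where
  r : ∀ {X Y : C}, (X ⟶ Y) → (X ⟶ Y) → Prop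
  refl : ∀ {X Y : C} (f : X ⟶ Y), r f f
  symm : ∀ {X Y : C} {f g : X ⟶ Y}, r f g → r g f
  trans : ∀ {X Y : C} {f g h : X ⟶ Y}, r f g → r g h → r f h
  pre : ∀ {X Y Z : C} (f : X ⟶ Y) {g h : Y ⟶ Z}, r g h → r (f ≫ g) (f ≫ h)
  post : ∀ {X Y Z : C} {f g : X ⟶ Y} (h : Y ⟶ Z), r f g → r (f ≫ h) (g ≫ h)
  wl : ∀ (Z : C) {X Y : C} {f g : X ⟶ Y}, r f g → r (Z ◁ f) (Z ◁ g)
  wr : ∀ {X Y : C} {f g : X ⟶ Y} (Z : C), r f g → r (f ▷ Z) (g ▷ Z)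

section Abs
variable {C : Type*} [Category C] [MonoidalCategory C] (R : MCong C)

/-- Isomorphism modulo the congruence. -/
def SIso {X Y : C} (f : X ⟶ Y) : Prop :=
  ∃ f' : Y ⟶ X, R.r (f ≫ f') (𝟙 X) ∧ R.r (f' ≫ f) (𝟙 Y)

lemma SIso.of_isIso {X Y : C} (f : X ⟶ Y) [IsIso f] : SIso R f :=
  ⟨inv f, by simpa using R.refl _, by simpa using R.refl _⟩

variable {R}

lemma SIso.comp {X Y Z : C} {f : X ⟶ Y} {g : Y ⟶ Z} (hf : SIso R f) (hg : SIso R g) :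
    SIso R (f ≫ g) := by
  obtain ⟨f', h1, h2⟩ := hf
  obtain ⟨g', h3, h4⟩ := hg
  refine ⟨g' ≫ f', ?_, ?_⟩
  · have := R.pre f (R.post f' h3)
    simp only [Category.assoc, Category.id_comp] at this ⊢
    exact R.trans this h1
  · have := R.pre g' (R.post g h2)
    simp only [Category.assoc, Category.id_comp] at this ⊢
    exact R.trans this h4

lemma SIso.wl (Z : C) {X Y : C} {f : X ⟶ Y} (hf : SIso R f) : SIso R (Z ◁ f) := by
  obtain ⟨f', h1, h2⟩ := hf
  exact ⟨Z ◁ f', by simpa using R.wl Z h1, by simpa using R.wl Z h2⟩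

lemma SIso.wr {X Y : C} {f : X ⟶ Y} (hf : SIso R f) (Z : C) : SIso R (f ▷ Z) := by
  obtain ⟨f', h1, h2⟩ := hf
  exact ⟨f' ▷ Z, by simpa using R.wr Z h1, by simpa using R.wr Z h2⟩

lemma SIso.cancel_left {X Y Z : C} {f : X ⟶ Y} (hf : SIso R f) {a b : Y ⟶ Z}
    (h : R.r (f ≫ a) (f ≫ b)) : R.r a b := by
  obtain ⟨f', h1, h2⟩ := hf
  have h3 := R.pre f' h
  have ha := R.post a h2
  have hb := R.post b h2
  simp only [Category.assoc, Category.id_comp] at h3 ha hb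
  exact R.trans (R.symm ha) (R.trans h3 hb)

lemma SIso.cancel_right {X Y Z : C} {f : Y ⟶ Z} (hf : SIso R f) {a b : X ⟶ Y}
    (h : R.r (a ≫ f) (b ≫ f)) : R.r a b := by
  obtain ⟨f', h1, h2⟩ := hf
  have h3 := R.post f' h
  have ha := R.pre a h1
  have hb := R.pre b h1
  simp only [Category.assoc, Category.comp_id] at h3 ha hb
  exact R.trans (R.symm ha) (R.trans h3 hb)

/-- the unit `Y ⟶ (Y ⊗ I) ⊗ D`. -/
def eta {I D : C} (c : 𝟙_ C ⟶ I ⊗ D) (Y : C) : Y ⟶ (Y ⊗ I) ⊗ D :=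
  (ρ_ Y).inv ≫ (Y ◁ c) ≫ (α_ Y I D).inv

lemma eta_siso {I D : C} {c : 𝟙_ C ⟶ I ⊗ D} (hc : SIso R c) (Y : C) : SIso R (eta c Y) :=
  (SIso.of_isIso R _).comp ((hc.wl Y).comp (SIso.of_isIso R _))

lemma eta_nat {I D : C} (c : 𝟙_ C ⟶ I ⊗ D) {Y A : C} (a : Y ⟶ A) :
    eta c Y ≫ ((a ▷ I) ▷ D) = a ≫ eta c A := by
  simp only [eta, Category.assoc]
  rw [← associator_inv_naturality_left, whisker_exchange_assoc, rightUnitor_inv_naturality_assoc]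

lemma faith {I D : C} {c : 𝟙_ C ⟶ I ⊗ D} (hc : SIso R c) {Y A : C} {a b : Y ⟶ A}
    (h : R.r (a ▷ I) (b ▷ I)) : R.r a b := by
  apply (eta_siso hc A).cancel_right
  rw [← eta_nat, ← eta_nat]
  exact R.pre _ (R.wr D h)

lemma full {I D : C} {c : 𝟙_ C ⟶ I ⊗ D} (hc : SIso R c) {c' : 𝟙_ C ⟶ D ⊗ I}
    (hc' : SIso R c') {Y A : C} (b : Y ⊗ I ⟶ A ⊗ I) : ∃ a : Y ⟶ A, R.r (a ▷ I) b := by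
  obtain ⟨e, h1, h2⟩ := eta_siso hc A
  refine ⟨eta c Y ≫ b ▷ D ≫ e, ?_⟩
  apply faith hc'
  apply (eta_siso hc Y).cancel_left
  rw [eta_nat]
  have := R.pre (eta c Y ≫ b ▷ D) h2
  simpa using this

end Abs

end EncPf


namespace EncPf
open Enc

variable {G : Type} [Group G] [Fintype G]

/-! ### The stable relation on `Rep ℤ G` -/

/-- A morphism is stably zero if it is a norm. -/
def SZ {X Y : Rep.{0} ℤ G} (f : X ⟶ Y) : Prop :=
  ∃ u : X.V →ₗ[ℤ] Y.V, ∀ x, f.hom x = ∑ g : G, Y.ρ g (u (X.ρ g⁻¹ x))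

lemma sz_zero {X Y : Rep.{0} ℤ G} : SZ (0 : X ⟶ Y) :=
  ⟨0, fun x => by simp⟩

lemma sz_neg {X Y : Rep.{0} ℤ G} {f : X ⟶ Y} (hf : SZ f) : SZ (-f) := by
  obtain ⟨u, hu⟩ := hf
  refine ⟨-u, fun x => ?_⟩
  simp [Rep.neg_hom, hu]

lemma sz_add {X Y : Rep.{0} ℤ G} {f g : X ⟶ Y} (hf : SZ f) (hg : SZ g) : SZ (f + g) := by
  obtain ⟨u, hu⟩ := hf
  obtain ⟨v, hv⟩ := hg
  refine ⟨u + v, fun x => ?_⟩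
  simp [Rep.add_hom, hu, hv, Finset.sum_add_distrib]

lemma sz_pre {X Y Z : Rep.{0} ℤ G} (f : X ⟶ Y) {g : Y ⟶ Z} (hg : SZ g) : SZ (f ≫ g) := by
  obtain ⟨u, hu⟩ := hg
  refine ⟨u ∘ₗ f.hom.toLinearMap, fun x => ?_⟩
  refine (hu (f.hom x)).trans ?_
  refine Finset.sum_congr rfl fun g _ => ?_
  show _ = Z.ρ g (u (f.hom (X.ρ g⁻¹ x)))
  rw [Rep.hom_comm_apply]

lemma sz_post {X Y Z : Rep.{0} ℤ G} {f : X ⟶ Y} (g : Y ⟶ Z) (hf : SZ f) : SZ (f ≫ g) := by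
  obtain ⟨u, hu⟩ := hf
  refine ⟨g.hom.toLinearMap ∘ₗ u, fun x => ?_⟩
  show g.hom (f.hom x) = ∑ h : G, Z.ρ h (g.hom (u (X.ρ h⁻¹ x)))
  rw [hu, map_sum]
  exact Finset.sum_congr rfl fun h _ => Rep.hom_comm_apply _ _ _

lemma sz_wl (Z : Rep.{0} ℤ G) {X Y : Rep.{0} ℤ G} {f : X ⟶ Y} (hf : SZ f) : SZ (Z ◁ f) := by
  obtain ⟨u, hu⟩ := hf
  refine ⟨TensorProduct.map LinearMap.id u, fun x => ?_⟩
  show TensorProduct.map LinearMap.id f.hom.toLinearMap x = ∑ g : G,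
    TensorProduct.map (Z.ρ g) (Y.ρ g) (TensorProduct.map LinearMap.id u
      (TensorProduct.map (Z.ρ g⁻¹) (X.ρ g⁻¹) x))
  induction x using TensorProduct.induction_on with
  | zero => simp
  | add x y hx hy => simp only [map_add, hx, hy, Finset.sum_add_distrib]
  | tmul z x =>
    simp only [TensorProduct.map_tmul, LinearMap.id_apply, Representation.self_inv_apply]
    rw [← TensorProduct.tmul_sum]
    exact congrArg _ (hu x)

lemma sz_wr {X Y : Rep.{0} ℤ G} {f : X ⟶ Y} (Z : Rep.{0} ℤ G) (hf : SZ f) : SZ (f ▷ Z) := by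
  obtain ⟨u, hu⟩ := hf
  refine ⟨TensorProduct.map u LinearMap.id, fun x => ?_⟩
  show TensorProduct.map f.hom.toLinearMap LinearMap.id x = ∑ g : G,
    TensorProduct.map (Y.ρ g) (Z.ρ g) (TensorProduct.map u LinearMap.id
      (TensorProduct.map (X.ρ g⁻¹) (Z.ρ g⁻¹) x))
  induction x using TensorProduct.induction_on with
  | zero => simp
  | add x y hx hy => simp only [map_add, hx, hy, Finset.sum_add_distrib]
  | tmul z x =>
    simp only [TensorProduct.map_tmul, LinearMap.id_apply, Representation.self_inv_apply]
    rw [← TensorProduct.sum_tmul]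
    exact congrArg (fun t => t ⊗ₜ[ℤ] x) (hu z)

lemma sz_ihom (Z : Rep.{0} ℤ G) {X Y : Rep.{0} ℤ G} {f : X ⟶ Y} (hf : SZ f) :
    SZ ((Rep.ihom Z).map f) := by
  obtain ⟨u, hu⟩ := hf
  refine ⟨LinearMap.llcomp ℤ Z.V X.V Y.V u, fun (x : Z.V →ₗ[ℤ] X.V) => ?_⟩
  show f.hom.toLinearMap ∘ₗ x = ∑ g : G,
    (Y.ρ g ∘ₗ (u ∘ₗ (X.ρ g⁻¹ ∘ₗ x ∘ₗ Z.ρ g⁻¹⁻¹)) ∘ₗ Z.ρ g⁻¹)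
  refine LinearMap.ext fun z => ?_
  rw [LinearMap.sum_apply]
  refine (hu (x z)).trans ?_
  simp

/-- The stable congruence on `Rep ℤ G`. -/
def stab (G : Type) [Group G] [Fintype G] : MCong (Rep.{0} ℤ G) where
  r f g := SZ (f - g)
  refl f := by rw [sub_self]; exact sz_zero
  symm h := by rw [← neg_sub]; exact sz_neg h
  trans h h' := by rw [← sub_add_sub_cancel]; exact sz_add h h'
  pre f _ _ h := by rw [← Preadditive.comp_sub]; exact sz_pre f h
  post f h := by rw [← Preadditive.sub_comp]; exact sz_post f h
  wl Z _ _ f g h := by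
    have : Z ◁ f - Z ◁ g = Z ◁ (f - g) := by
      rw [sub_eq_iff_eq_add, ← MonoidalPreadditive.whiskerLeft_add, sub_add_cancel]
    rw [this]; exact sz_wl Z h
  wr {_ _ f g} Z h := by
    have : f ▷ Z - g ▷ Z = (f - g) ▷ Z := by
      rw [sub_eq_iff_eq_add, ← MonoidalPreadditive.add_whiskerRight, sub_add_cancel]
    rw [this]; exact sz_wr Z h

lemma stab_curry {X Y A : Rep.{0} ℤ G} {f g : X ⊗ Y ⟶ A} :
    (stab G).r (MonoidalClosed.curry f) (MonoidalClosed.curry g) ↔ (stab G).r f g := by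
  constructor
  · intro h
    have := (stab G).post ((ihom.ev X).app A) ((stab G).wl X h)
    rwa [← MonoidalClosed.uncurry_eq, ← MonoidalClosed.uncurry_eq,
      MonoidalClosed.uncurry_curry, MonoidalClosed.uncurry_curry] at this
  · intro h
    rw [MonoidalClosed.curry_eq, MonoidalClosed.curry_eq]
    apply (stab G).pre
    have : (ihom X).map f - (ihom X).map g = (Rep.ihom X).map (f - g) := by
      rfl
    show SZ _
    rw [this]
    exact sz_ihom X h

/-! ### Tate classes and morphisms -/

/-- Currying, with target spelled `hRep`. -/
noncomputable def cur {X Y A : Rep.{0} ℤ G} (f : X ⊗ Y ⟶ A) : Y ⟶ hRep X A :=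
  MonoidalClosed.curry f

/-- Evaluation, with source spelled `hRep`. -/
noncomputable def icev (X A : Rep.{0} ℤ G) : X ⊗ hRep X A ⟶ A := (ihom.ev X).app A

lemma cur_icev {X Y A : Rep.{0} ℤ G} (f : X ⊗ Y ⟶ A) : X ◁ cur f ≫ icev X A = f :=
  (MonoidalClosed.uncurry_eq _).symm.trans (MonoidalClosed.uncurry_curry f)

lemma cur_left {X Y Y' A : Rep.{0} ℤ G} (g : Y' ⟶ Y) (f : X ⊗ Y ⟶ A) :
    g ≫ cur f = cur (X ◁ g ≫ f) :=
  (MonoidalClosed.curry_natural_left _ _).symm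

lemma cur_right {X Y A B : Rep.{0} ℤ G} (f : X ⊗ Y ⟶ A) (φ : A ⟶ B) :
    cur f ≫ (Rep.ihom X).map φ = cur (f ≫ φ) :=
  (MonoidalClosed.curry_natural_right f φ).symm

lemma mkCls_surj {n : ℤ} {W : Rep ℤ G} (z : tate n W) : ∃ m : J G n ⟶ W, mkCls m = z := by
  induction z using Quotient.inductionOn with | _ z => ?_
  obtain ⟨f, hf⟩ := z
  have h : ∀ g : G, f ∘ₗ (J G n).ρ g = W.ρ g ∘ₗ f := fun g => by
    have h : W.ρ g ∘ₗ f ∘ₗ (J G n).ρ g⁻¹ = f := hf g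
    refine LinearMap.ext fun x => ?_
    have := LinearMap.congr_fun h ((J G n).ρ g x)
    refine this.symm.trans ?_
    exact congrArg (fun t => W.ρ g ((show (J G n).V →ₗ[ℤ] W.V from f) t))
      (Representation.inv_self_apply (J G n).ρ g x)
  exact ⟨Rep.ofHom (ρ := (J G n).ρ) (σ := W.ρ) ⟨f, h⟩, rfl⟩

lemma rnorm_apply' {X W : Rep.{0} ℤ G} (u w : X.V →ₗ[ℤ] W.V)
    (h : rnorm ((hRep X W).ρ) u = w) (x : X.V) :
    w x = ∑ g : G, W.ρ g (u (X.ρ g⁻¹ x)) := by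
  have h1 : rnorm ((hRep X W).ρ) u = ∑ h : G, ((hRep X W).ρ h) u :=
    LinearMap.sum_apply _ _ _
  rw [← h, h1]
  exact LinearMap.sum_apply _ _ _

lemma mkCls_eq {n : ℤ} {W : Rep ℤ G} (a b : J G n ⟶ W) :
    mkCls a = mkCls b ↔ (stab G).r a b := by
  refine (Submodule.Quotient.eq _).trans ?_
  constructor
  · rintro ⟨u, hu⟩
    refine ⟨u, fun x => ?_⟩
    exact rnorm_apply' u _ (congrArg Subtype.val hu) x
  · rintro ⟨u, hu⟩
    refine ⟨u, Subtype.ext ?_⟩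
    refine LinearMap.ext fun x => ?_
    exact (rnorm_apply' u _ rfl x).trans (hu x).symm

lemma tmap_mkCls {n : ℤ} {M N : Rep ℤ G} (φ : M ⟶ N) (f : J G n ⟶ M) :
    tmap n φ (mkCls f) = mkCls (f ≫ φ) := rfl

lemma cup_mkCls {i j : ℤ} {M N : Rep ℤ G} (f : J G i ⟶ M) (g : J G j ⟶ N) :
    cup (mkCls f) (mkCls g) = mkCls (μ G i j ≫ (f ⊗ₘ g)) := rfl

/-- The canonical map `J 1 ⟶ I_G`. -/
noncomputable def lam (G : Type) [Group G] [Fintype G] : J G 1 ⟶ IGrep G := (λ_ (IGrep G)).hom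

/-- The fundamental class. -/
noncomputable def cls (G : Type) [Group G] [Fintype G] : tate 1 (IGrep G) := mkCls (lam G)

lemma mu_one (i : ℤ) {M : Rep ℤ G} (f : J G i ⟶ M) :
    μ G i 1 ≫ (f ⊗ₘ lam G) = sMap i ≫ (f ▷ IGrep G) := by
  have e : ∀ (k : ℤ) (h : i = k) (p : J G k = J G i) (q : J G (i + 1) = J G (k + 1)),
      (eqToHom q ≫ sMap k ≫ ((eqToHom p ≫ (ρ_ (J G i)).inv) ▷ IGrep G) ≫
        (α_ (J G i) (𝟙_ _) (IGrep G)).hom) ≫ (f ⊗ₘ (λ_ (IGrep G)).hom)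
        = sMap i ≫ (f ▷ IGrep G) := by
    rintro k rfl p q
    simp [tensorHom_def']
  exact e (i + (0 : ℕ)) (by simp) (by simp) (by simp)

lemma cup_cls (i : ℤ) {M : Rep ℤ G} (f : J G i ⟶ M) :
    cup (mkCls f) (cls G) = mkCls (sMap i ≫ (f ▷ IGrep G)) :=
  (cup_mkCls f (lam G)).trans (congrArg mkCls (mu_one i f))

lemma pr0_def (X A : Rep ℤ G) :
    pr0 X A = cur ((α_ X (hRep X A) (IGrep G)).inv ≫ (icev X A ▷ IGrep G)) := rfl

lemma pr0_eq (X A : Rep ℤ G) {Y : Rep ℤ G} (f : X ⊗ Y ⟶ A) :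
    (cur f ▷ IGrep G) ≫ pr0 X A
      = cur ((α_ X Y (IGrep G)).inv ≫ (f ▷ IGrep G)) := by
  rw [pr0_def, cur_left, associator_inv_naturality_middle_assoc, ← comp_whiskerRight, cur_icev]

lemma main_map (X A : Rep ℤ G) (i : ℤ) (f : X ⊗ J G i ⟶ A) :
    tmap (i + 1) (pr0 X A) (cup (mkCls (cur f)) (cls G)) =
      mkCls (cur
        (((X ◁ sMap i) ≫ (α_ X (J G i) (IGrep G)).inv) ≫ (f ▷ IGrep G))) := by
  rw [cup_cls, tmap_mkCls, Category.assoc, pr0_eq, Category.assoc, cur_left]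

lemma curry_surj {X A Y : Rep ℤ G} (m : Y ⟶ hRep X A) :
    ∃ f : X ⊗ Y ⟶ A, m = cur f :=
  ⟨MonoidalClosed.uncurry m, (MonoidalClosed.curry_uncurry _).symm⟩

lemma naturality (X : Rep ℤ G) (i : ℤ) {A B : Rep ℤ G} (φ : A ⟶ B) (z : tate i (hRep X A)) :
    tmap (i + 1) (pr0 X B) (cup (tmap i ((Rep.ihom X).map φ) z) (cls G)) =
      tmap (i + 1) ((Rep.ihom X).map (φ ▷ IGrep G))
        (tmap (i + 1) (pr0 X A) (cup z (cls G))) := by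
  obtain ⟨m, rfl⟩ := mkCls_surj z
  obtain ⟨f, rfl⟩ := curry_surj m
  rw [main_map, tmap_mkCls, tmap_mkCls, cur_right, cur_right, main_map]
  simp

lemma bijective_of (X : Rep ℤ G) (i : ℤ) (hs : SIso (stab G) (sMap (G := G) i))
    {D : Rep ℤ G} {c : 𝟙_ (Rep ℤ G) ⟶ IGrep G ⊗ D} (hc : SIso (stab G) c)
    {c' : 𝟙_ (Rep ℤ G) ⟶ D ⊗ IGrep G} (hc' : SIso (stab G) c') (A : Rep ℤ G) :
    Function.Bijective
      (fun z : tate i (hRep X A) => tmap (i + 1) (pr0 X A) (cup z (cls G))) := by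
  have ht : SIso (stab G) ((X ◁ sMap i) ≫ (α_ X (J G i) (IGrep G)).inv) :=
    (hs.wl X).comp (SIso.of_isIso _ _)
  constructor
  · intro z z' h
    obtain ⟨m, rfl⟩ := mkCls_surj z
    obtain ⟨f, rfl⟩ := curry_surj m
    obtain ⟨m, rfl⟩ := mkCls_surj z'
    obtain ⟨f', rfl⟩ := curry_surj m
    simp only [main_map] at h
    have h := (mkCls_eq _ _).1 h
    have h := stab_curry.1 h
    exact (mkCls_eq _ _).2 (stab_curry.2 (faith hc (ht.cancel_left h)))
  · intro z
    obtain ⟨m, rfl⟩ := mkCls_surj z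
    obtain ⟨b, rfl⟩ := curry_surj m
    obtain ⟨t', h1, h2⟩ := ht
    obtain ⟨a, ha⟩ := full hc hc' (t' ≫ b)
    refine ⟨mkCls (cur a), ?_⟩
    simp only [main_map]
    refine (mkCls_eq _ _).2 (stab_curry.2 ?_)
    refine (stab G).trans ((stab G).pre _ ha) ?_
    have := (stab G).post b h1
    rwa [Category.id_comp, Category.assoc] at this

lemma smap_siso (h : SIso (stab G) (coev G)) : ∀ i : ℤ, SIso (stab G) (sMap (G := G) i)
  | .ofNat m => SIso.of_isIso _ (𝟙 (Jp G m ⊗ IGrep G))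
  | .negSucc 0 =>
      h.comp ((SIso.of_isIso _ (β_ (IGrep G) (DIG G)).hom).comp
        (SIso.of_isIso _ ((λ_ (DIG G)).inv ▷ IGrep G)))
  | .negSucc (m+1) =>
      (SIso.of_isIso _ (ρ_ (Jn G (m+1))).inv).comp
        (((h.comp (SIso.of_isIso _ (β_ (IGrep G) (DIG G)).hom)).wl (Jn G (m+1))).comp
          (SIso.of_isIso _ (α_ (Jn G (m+1)) (DIG G) (IGrep G)).inv))

end EncPf


namespace EncPf
open Enc

variable {G : Type} [Group G] [Fintype G]

/-! ### The coevaluation is a stable isomorphism -/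

/-- The element `g - 1` of the augmentation ideal. -/
noncomputable def bb (g : G) : IGcar G :=
  ⟨Finsupp.single g 1 - Finsupp.single 1 1, by simp [aug]⟩

/-- The coordinate functionals. -/
noncomputable def dl (g : G) : Module.Dual ℤ (IGcar G) :=
  (Finsupp.lapply g : (G →₀ ℤ) →ₗ[ℤ] ℤ) ∘ₗ (LinearMap.ker (aug G)).subtype

lemma dl_apply (g : G) (y : IGcar G) : dl g y = y.1 g := rfl

lemma aug_eq (x : G →₀ ℤ) : aug G x = ∑ g : G, x g := by
  simp [aug, Finsupp.linearCombination_apply, Finsupp.sum_fintype]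

lemma sum_dl_apply (y : IGcar G) : ∑ g : G, dl g y = 0 := by
  have := y.2
  rw [LinearMap.mem_ker, aug_eq] at this
  exact this

lemma sum_dl : ∑ g : G, dl g = 0 := by
  refine LinearMap.ext fun y => ?_
  rw [LinearMap.sum_apply, sum_dl_apply]; rfl

lemma sum_bb (y : IGcar G) : ∑ g : G, dl g y • bb g = y := by
  classical
  apply Subtype.ext
  rw [AddSubmonoidClass.coe_finsetSum]
  have h0 := sum_dl_apply y
  have : ∀ g : G, ((dl g y • bb g : IGcar G) : G →₀ ℤ)
      = Finsupp.single g (y.1 g) - dl g y • Finsupp.single 1 1 := by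
    intro g
    show dl g y • (Finsupp.single g 1 - Finsupp.single 1 1) = _
    rw [smul_sub]
    simp [dl_apply]
  rw [Finset.sum_congr rfl fun g _ => this g, Finset.sum_sub_distrib, ← Finset.sum_smul, h0,
    zero_smul, sub_zero]
  exact Finsupp.univ_sum_single y.1

lemma sum_f (f : Module.Dual ℤ (IGcar G)) : ∑ g : G, f (bb g) • dl g = f := by
  refine LinearMap.ext fun y => ?_
  conv_rhs => rw [← sum_bb y, map_sum]
  rw [LinearMap.sum_apply]
  refine Finset.sum_congr rfl fun g _ => ?_
  simp [mul_comm]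

lemma rho_bb (h g : G) : IGρ G h (bb g) = bb (h * g) - bb h := by
  apply Subtype.ext
  show ofMulActionFinsupp ℤ G G h (Finsupp.single g 1 - Finsupp.single 1 1)
    = (Finsupp.single (h * g) 1 - Finsupp.single 1 1) - (Finsupp.single h 1 - Finsupp.single 1 1)
  rw [map_sub]
  simp [ofMulActionFinsupp, Finsupp.mapDomain_single]

lemma dl_rho (h g : G) (y : IGcar G) : dl g (IGρ G h⁻¹ y) = dl (h * g) y := by
  show ofMulActionFinsupp ℤ G G h⁻¹ y.1 g = y.1 (h * g)
  have := Finsupp.mapDomain_apply (f := fun x : G => h⁻¹ • x) (MulAction.injective h⁻¹) y.1 (h * g)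
  simpa [ofMulActionFinsupp] using this

/-- Dual action. -/
noncomputable def dact (g : G) : Module.Dual ℤ (IGcar G) →ₗ[ℤ] Module.Dual ℤ (IGcar G) :=
  LinearMap.lcomp ℤ ℤ (IGρ G g⁻¹)

lemma dact_dl (h g : G) : dact h (dl g) = dl (h * g) :=
  LinearMap.ext fun y => dl_rho h g y

lemma coevElt_eq : (show IGcar G ⊗[ℤ] Module.Dual ℤ (IGcar G) from coevElt G)
    = ∑ g : G, bb g ⊗ₜ[ℤ] dl g := by
  have h : preElt G = ∑ g : G, dl g ⊗ₜ[ℤ] bb g := by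
    apply (dualTensorHomEquiv ℤ (IGcar G) (IGcar G)).injective
    rw [preElt, LinearEquiv.apply_symm_apply, map_sum]
    refine LinearMap.ext fun y => ?_
    rw [LinearMap.sum_apply]
    simp [dualTensorHom_apply, sum_bb]
  show TensorProduct.comm ℤ _ _ (preElt G) = _
  rw [h, map_sum]
  rfl

/-- The map whose norm exhibits the stable inverse. -/
noncomputable def uu (G : Type) [Group G] [Fintype G] :
    IGcar G ⊗[ℤ] Module.Dual ℤ (IGcar G) →ₗ[ℤ] IGcar G ⊗[ℤ] Module.Dual ℤ (IGcar G) :=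
  ∑ k : G, (LinearMap.toSpanSingleton ℤ _ (bb k ⊗ₜ[ℤ] dl (1 : G))) ∘ₗ
    (TensorProduct.lid ℤ ℤ).toLinearMap ∘ₗ
      TensorProduct.map (dl k) (Module.Dual.eval ℤ (IGcar G) (bb k))

lemma uu_tmul (y : IGcar G) (f : Module.Dual ℤ (IGcar G)) :
    uu G (y ⊗ₜ f) = ∑ k : G, (dl k y * f (bb k)) • (bb k ⊗ₜ[ℤ] dl (1 : G)) := by
  rw [uu, LinearMap.sum_apply]
  refine Finset.sum_congr rfl fun k _ => ?_
  simp

lemma f_apply (y : IGcar G) (f : Module.Dual ℤ (IGcar G)) :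
    f y = ∑ k : G, dl k y * f (bb k) := by
  conv_lhs => rw [← sum_bb y, map_sum]
  simp

lemma bil_norm {R I D M ι : Type*} [Fintype ι] [CommRing R] [AddCommGroup I] [Module R I]
    [AddCommGroup D] [Module R D] [AddCommGroup M] [Module R M]
    (B : I →ₗ[R] D →ₗ[R] M) (b : ι → I) (d : ι → D) (c p : ι → R) (y : I) (f : D) (fy : R)
    (hy : ∑ k, c k • b k = y) (hc : ∑ k, c k = 0) (hd : ∑ k, d k = 0)
    (hf : ∑ k, p k • d k = f) (hfy : fy = ∑ k, c k * p k) :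
    ∑ g, ∑ k, (c k * (p k - p g)) • B (b k - b g) (d g)
      = (-fy) • ∑ g, B (b g) (d g) - B y f := by
  have h3 : ∀ g, ∑ k, (c k * (p k - p g)) • B (b k - b g) (d g)
      = B (∑ k, (c k * p k) • b k) (d g) - fy • B (b g) (d g)
        - B y (p g • d g) + ((∑ k, c k) * p g) • B (b g) (d g) := by
    intro g
    rw [hfy, ← hy, map_sum, map_sum, LinearMap.sum_apply, LinearMap.sum_apply, Finset.sum_smul,
      Finset.sum_mul, Finset.sum_smul, ← Finset.sum_sub_distrib, ← Finset.sum_sub_distrib,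
      ← Finset.sum_add_distrib]
    refine Finset.sum_congr rfl fun k _ => ?_
    simp only [map_sub, map_smul, LinearMap.sub_apply, LinearMap.smul_apply]
    module
  rw [Finset.sum_congr rfl fun g _ => h3 g]
  simp only [hc, zero_mul, zero_smul, add_zero]
  rw [Finset.sum_sub_distrib, Finset.sum_sub_distrib, ← map_sum, ← map_sum, hd, hf,
    map_zero, zero_sub, ← Finset.smul_sum, neg_smul]

lemma bil_normZ {I D M ι : Type*} [Fintype ι] [AddCommGroup I]
    [AddCommGroup D] [AddCommGroup M]
    (B : I → D → M) (h1 : ∀ a a' b, B (a + a') b = B a b + B a' b)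
    (h2 : ∀ a b b', B a (b + b') = B a b + B a b')
    (b : ι → I) (d : ι → D) (c p : ι → ℤ) (y : I) (f : D) (fy : ℤ)
    (hy : ∑ k, c k • b k = y) (hc : ∑ k, c k = 0) (hd : ∑ k, d k = 0)
    (hf : ∑ k, p k • d k = f) (hfy : fy = ∑ k, c k * p k) :
    ∑ g, ∑ k, (c k * (p k - p g)) • B (b k - b g) (d g)
      = (-fy) • ∑ g, B (b g) (d g) - B y f :=
  bil_norm (R := ℤ) (AddMonoidHom.toIntLinearMap (AddMonoidHom.mk'
    (fun a => AddMonoidHom.toIntLinearMap (AddMonoidHom.mk' (B a) (h2 a)))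
    (fun a a' => LinearMap.ext fun b => h1 a a' b))) b d c p y f fy hy hc hd hf hfy

lemma uu_norm (y : IGcar G) (f : Module.Dual ℤ (IGcar G)) :
    ∑ g : G, TensorProduct.map (IGρ G g) (dact g) (uu G ((IGρ G g⁻¹ y) ⊗ₜ (dact g⁻¹ f)))
      = (-(f y)) • (∑ g : G, bb g ⊗ₜ[ℤ] dl g) - y ⊗ₜ[ℤ] f := by
  have h1 : ∀ g : G,
      TensorProduct.map (IGρ G g) (dact g) (uu G ((IGρ G g⁻¹ y) ⊗ₜ (dact g⁻¹ f)))
      = ∑ k : G, (dl k y * (f (bb k) - f (bb g))) • ((bb k - bb g) ⊗ₜ[ℤ] dl g) := by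
    intro g
    rw [uu_tmul, map_sum, ← Equiv.sum_comp (Equiv.mulLeft g)
      (fun k => (dl k y * (f (bb k) - f (bb g))) • ((bb k - bb g) ⊗ₜ[ℤ] dl g))]
    refine Finset.sum_congr rfl fun k _ => ?_
    have h2 : (dact g⁻¹ f) (bb k) = f (bb (g * k)) - f (bb g) := by
      show f (IGρ G g⁻¹⁻¹ (bb k)) = _
      rw [inv_inv, rho_bb, map_sub]
    rw [map_smul, TensorProduct.map_tmul, rho_bb, dact_dl, dl_rho, h2, mul_one]
    rfl
  rw [Finset.sum_congr rfl fun g _ => h1 g]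
  have hy : ∑ k : G, dl k y • bb k = y := by
    conv_rhs => rw [← sum_bb y]
  have hf : ∑ k : G, f (bb k) • dl k = f := by
    conv_rhs => rw [← sum_f f]
  exact bil_normZ (fun a b => a ⊗ₜ[ℤ] b) (fun a a' b => TensorProduct.add_tmul a a' b)
    (fun a b b' => TensorProduct.tmul_add a b b') bb dl (fun k => dl k y)
    (fun k => f (bb k)) y f (f y) hy (sum_dl_apply y) sum_dl hf (f_apply y f)

lemma ev_coev : ∑ g : G, dl g (bb g) = (Fintype.card G : ℤ) - 1 := by
  classical
  have : ∀ g : G, dl g (bb g) = 1 - if g = 1 then 1 else 0 := by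
    intro g
    rw [dl_apply]
    simp [bb, Finsupp.single_apply, eq_comm]
  rw [Finset.sum_congr rfl fun g _ => this g]
  simp

/-- Evaluation as a linear map. -/
noncomputable def evL (G : Type) [Group G] [Fintype G] :
    IGcar G ⊗[ℤ] Module.Dual ℤ (IGcar G) →ₗ[ℤ] ℤ :=
  (icev (IGrep G) (𝟙_ (Rep ℤ G))).hom.toLinearMap

lemma evL_tmul (y : IGcar G) (f : Module.Dual ℤ (IGcar G)) : evL G (y ⊗ₜ[ℤ] f) = f y := rfl

/-- The coevaluation element, as an element of the tensor product. -/
noncomputable def cE (G : Type) [Group G] [Fintype G] :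
    IGcar G ⊗[ℤ] Module.Dual ℤ (IGcar G) := coevElt G

lemma cE_eq : cE G = ∑ g : G, bb g ⊗ₜ[ℤ] dl g := coevElt_eq

lemma evL_cE : evL G (cE G) = (Fintype.card G : ℤ) - 1 := by
  rw [cE_eq, map_sum, ← ev_coev]
  rfl

lemma norm_full (x : IGcar G ⊗[ℤ] Module.Dual ℤ (IGcar G)) :
    (-(evL G x)) • cE G - x = ∑ g : G,
      TensorProduct.map (IGρ G g) (dact g) (uu G (TensorProduct.map (IGρ G g⁻¹) (dact g⁻¹) x)) := by
  rw [sub_eq_iff_eq_add]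
  induction x using TensorProduct.induction_on with
  | zero => simp
  | tmul y f =>
    rw [← sub_eq_iff_eq_add, cE_eq]
    exact (uu_norm y f).symm
  | add x y hx hy =>
    simp only [map_add, Finset.sum_add_distrib, neg_add, add_smul, hx, hy]
    abel

lemma coev_siso : SIso (stab G) (coev G) := by
  refine ⟨-icev (IGrep G) (𝟙_ (Rep ℤ G)), ?_, ?_⟩
  · refine ⟨-LinearMap.id, fun (z : ℤ) => ?_⟩
    show -(evL G (z • cE G)) - z = ∑ g : G, -z
    rw [map_smul, evL_cE, Finset.sum_const, Finset.card_univ]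
    simp only [smul_neg, nsmul_eq_mul, smul_eq_mul]
    ring
  · exact ⟨uu G, fun x => norm_full x⟩

end EncPf

open CategoryTheory MonoidalCategory Enc

theorem statement0 (G : Type) [Group G] [Fintype G] :
    ∃ c : tate 1 (IGrep G), ∀ (X : Rep ℤ G) (i : ℤ),
      (∀ {A B : Rep ℤ G} (φ : A ⟶ B) (z : tate i (hRep X A)),
          tmap (i + 1) (pr0 X B) (cup (tmap i ((Rep.ihom X).map φ) z) c) =
            tmap (i + 1) ((Rep.ihom X).map (φ ▷ IGrep G)) (tmap (i + 1) (pr0 X A) (cup z c))) ∧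
      ∀ A : Rep ℤ G,
        Function.Bijective (fun z : tate i (hRep X A) => tmap (i + 1) (pr0 X A) (cup z c)) := by
  refine ⟨EncPf.cls G, fun X i => ⟨fun φ z => EncPf.naturality X i φ z, fun A => ?_⟩⟩
  exact EncPf.bijective_of X i (EncPf.smap_siso EncPf.coev_siso i) EncPf.coev_siso
    (EncPf.coev_siso.comp (EncPf.SIso.of_isIso _ (β_ (IGrep G) (DIG G)).hom)) A
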